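/- arXiv:math/0006212 — 8 statements merged into one kernel-verified Lean document; each statement's English description precedes it below -/
import Mathlib

section
/- Let (V, ω) be a symplectic real vector space of dimension 2n with n ≥ 2, and let T : V × V × V → ℝ be a trilinear map that is symmetric in its last two arguments and satisfies, for all X, Y, Z, W, U ∈ V, the cyclic identity Σ_{cyc(X,Y,Z)} [ 2ω(Y,Z)T(X,W,U) + ω(Y,W)T(X,Z,U) + ω(Y,U)T(X,Z,W) − ω(Z,W)T(X,Y,U) − ω(Z,U)T(X,Y,W) ] = 0, where Σ_{cyc(X,Y,Z)} denotes the sum over the three cyclic permutations of (X,Y,Z). Then there exists a linear form u ∈ V* such that T(X,Y,Z) = (1/(2n+1)) (ω(X,Y)u(Z) + ω(X,Z)u(Y)) for all X, Y, Z ∈ V. -/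
/-- In a symplectic real vector space of dimension `2n`, `n ≥ 2`, a trilinear
map `T` symmetric in its last two arguments satisfying the cyclic identity is of the form
`T(X,Y,Z) = (1/(2n+1))(ω(X,Y)u(Z) + ω(X,Z)u(Y))` for some linear form `u`. -/
theorem ricci_type_covariant_derivative_form
    (n : ℕ) (hn : 2 ≤ n)
    (V : Type*) [AddCommGroup V] [Module ℝ V] [FiniteDimensional ℝ V]
    (hdim : Module.finrank ℝ V = 2 * n)
    (ω : V →ₗ[ℝ] V →ₗ[ℝ] ℝ)
    (halt : ∀ X : V, ω X X = 0)
    (hnondeg : ∀ X : V, (∀ Y : V, ω X Y = 0) → X = 0)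
    (T : V →ₗ[ℝ] V →ₗ[ℝ] V →ₗ[ℝ] ℝ)
    (hTsym : ∀ X Y Z : V, T X Y Z = T X Z Y)
    (hcyc : ∀ X Y Z W U : V,
      (2 * ω Y Z * T X W U + ω Y W * T X Z U + ω Y U * T X Z W
        - ω Z W * T X Y U - ω Z U * T X Y W)
      + (2 * ω Z X * T Y W U + ω Z W * T Y X U + ω Z U * T Y X W
        - ω X W * T Y Z U - ω X U * T Y Z W)
      + (2 * ω X Y * T Z W U + ω X W * T Z Y U + ω X U * T Z Y W
        - ω Y W * T Z X U - ω Y U * T Z X W) = 0) :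
    ∃ u : V →ₗ[ℝ] ℝ, ∀ X Y Z : V,
      T X Y Z = (1 / (2 * (n : ℝ) + 1)) * (ω X Y * u Z + ω X Z * u Y) := by
  have hsk : ∀ X Y : V, ω X Y = - ω Y X := by
    intro X Y
    have h := halt (X + Y)
    simp only [map_add, LinearMap.add_apply, halt] at h
    linarith
  have hex : ∀ X : V, X ≠ 0 → ∃ Z, ω X Z ≠ 0 := by
    intro X hX
    by_contra! h
    exact hX (hnondeg X h)
  -- a hyperbolic pair orthogonal to a nonzero vector
  have hpair : ∀ X : V, X ≠ 0 → ∃ Y Z, ω X Y = 0 ∧ ω X Z = 0 ∧ ω Y Z ≠ 0 := by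
    intro X hX
    by_contra! h
    obtain ⟨Z0, hZ0⟩ := hex X hX
    have hproj : ∀ W, ω X (W - (ω X W / ω X Z0) • Z0) = 0 := by
      intro W
      simp only [map_sub, map_smul, smul_eq_mul]
      field_simp
      ring
    have htop : (⊤ : Submodule ℝ V) ≤ Submodule.span ℝ {X, Z0} := by
      intro Y _
      rw [Submodule.mem_span_pair]
      set Y' := Y - (ω X Y / ω X Z0) • Z0 with hY'
      refine ⟨ω Y' Z0 / ω X Z0, ω X Y / ω X Z0, ?_⟩
      have h0 : Y' - (ω Y' Z0 / ω X Z0) • X = 0 := by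
        apply hnondeg
        intro W
        have h1 := h Y' _ (hproj Y) (hproj W)
        simp only [map_sub, map_smul, smul_eq_mul, LinearMap.sub_apply,
          LinearMap.smul_apply] at h1 ⊢
        rw [← h1]
        ring
      have h2 := sub_eq_zero.mp h0
      rw [← h2, hY']
      abel
    have h3 := Submodule.finrank_mono htop
    have h4 : Module.finrank ℝ (Submodule.span ℝ ({X, Z0} : Set V)) ≤ 2 := by
      classical
      have h5 := finrank_span_finset_le_card (R := ℝ) ({X, Z0} : Finset V)
      have h6 : ({X, Z0} : Finset V).card ≤ 2 := Finset.card_le_two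
      simp only [Finset.coe_insert, Finset.coe_singleton] at h5
      exact h5.trans h6
    rw [finrank_top, hdim] at h3
    omega
  have hcube : ∀ X : V, T X X X = 0 := by
    intro X
    by_cases hX : X = 0
    · simp [hX]
    obtain ⟨Y, Z, hY, hZ, hYZ⟩ := hpair X hX
    have h := hcyc X Y Z X X
    have hY' : ω Y X = 0 := by rw [hsk, hY, neg_zero]
    have hZ' : ω Z X = 0 := by rw [hsk, hZ, neg_zero]
    simp only [hY, hZ, hY', hZ', halt] at h
    have h2 : ω Y Z * T X X X = 0 := by linarith
    exact (mul_eq_zero.mp h2).resolve_left hYZ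
  have hpol : ∀ X Y : V, T Y X X = -2 * T X Y X := by
    intro X Y
    have h1 := hcube (Y + X)
    have h2 := hcube (Y - X)
    simp only [map_add, map_sub, LinearMap.add_apply, LinearMap.sub_apply, hcube] at h1 h2
    have := hTsym X Y X
    linarith
  have hprop : ∀ X Y Z : V, ω Z X * T Y X X = ω Y X * T Z X X := by
    intro X Y Z
    have h := hcyc X Y Z X X
    rw [hcube, halt, hsk X Y, hTsym X Z X] at h
    have e1 := hpol X Y
    have e2 := hpol X Z
    have e3 := hTsym X Y X
    have e4 := hTsym X Z X
    have f1 : T X Y X = -(1/2) * T Y X X := by linarith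
    have f2 : T X X Z = -(1/2) * T Z X X := by linarith
    have f3 : T X Z X = -(1/2) * T Z X X := by linarith
    simp only [f1, f2, f3] at h
    linarith
  have hc : ∀ X : V, ∃ c : ℝ, (X = 0 → c = 0) ∧ ∀ Y, T Y X X = 2 * ω Y X * c := by
    intro X
    by_cases hX : X = 0
    · exact ⟨0, fun _ => rfl, by simp [hX]⟩
    obtain ⟨Z, hZ⟩ := hex X hX
    have hZ' : ω Z X ≠ 0 := by rw [hsk]; exact neg_ne_zero.mpr hZ
    refine ⟨T Z X X / (2 * ω Z X), fun h => absurd h hX, fun Y => ?_⟩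
    have := hprop X Y Z
    field_simp
    linarith
  choose c hc0 hcT using hc
  have hsmul : ∀ (t : ℝ) (X : V), c (t • X) = t * c X := by
    intro t X
    by_cases hX : X = 0
    · simp [hX, hc0 0 rfl]
    by_cases ht : t = 0
    · simp [ht, hc0 0 rfl]
    obtain ⟨Z, hZ⟩ := hex X hX
    have hZ' : ω Z X ≠ 0 := by rw [hsk]; exact neg_ne_zero.mpr hZ
    have h1 := hcT (t • X) Z
    simp only [map_smul, LinearMap.smul_apply, smul_eq_mul, hcT X Z] at h1
    have h2 : (t * ω Z X) * (c (t • X) - t * c X) = 0 := by linarith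
    have h3 := (mul_eq_zero.mp h2).resolve_left (mul_ne_zero ht hZ')
    linarith
  have hpr : ∀ (t : ℝ) (X : V), c (X + t • X) = c X + c (t • X) := by
    intro t X
    have : X + t • X = (1 + t) • X := by rw [add_smul, one_smul]
    rw [this, hsmul, hsmul]
    ring
  have hadd : ∀ X Z : V, c (X + Z) = c X + c Z := by
    intro X Z
    obtain ⟨a, ha⟩ : ∃ a, a = c (X + Z) + c (X - Z) - 2 * c X := ⟨_, rfl⟩
    obtain ⟨b, hb⟩ : ∃ b, b = c (X + Z) - c (X - Z) - 2 * c Z := ⟨_, rfl⟩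
    have h0 : a • X + b • Z = 0 := by
      apply hnondeg
      intro Y
      rw [hsk]
      have h1 := hcT (X + Z) Y
      have h2 := hcT (X - Z) Y
      have h3 := hcT X Y
      have h4 := hcT Z Y
      simp only [map_add, map_sub, map_smul, smul_eq_mul, LinearMap.add_apply,
        LinearMap.sub_apply] at h1 h2 ⊢
      rw [ha, hb]
      linarith
    by_cases ha0 : a = 0
    · by_cases hb0 : b = 0
      · linarith
      · have hz : Z = 0 := by simpa [ha0, hb0] using h0
        simp [hz, hc0 0 rfl]
    · have hx : X = (-(b / a)) • Z := by
        have h5 : a • X = -(b • Z) := eq_neg_of_add_eq_zero_left h0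
        have h6 : X = a⁻¹ • (a • X) := by rw [smul_smul, inv_mul_cancel₀ ha0, one_smul]
        rw [h6, h5, smul_neg, smul_smul, neg_smul]
        congr 2
        ring
      rw [hx, add_comm, hpr, add_comm]
  let u : V →ₗ[ℝ] ℝ :=
    { toFun := fun X => (2 * (n : ℝ) + 1) * c X
      map_add' := fun X Y => by rw [hadd]; ring
      map_smul' := fun t X => by rw [hsmul]; simp only [RingHom.id_apply, smul_eq_mul]; ring }
  refine ⟨u, fun X Y Z => ?_⟩
  have hu : ∀ X, u X = (2 * (n : ℝ) + 1) * c X := fun _ => rfl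
  have hn0 : (2 * (n : ℝ) + 1) ≠ 0 := by positivity
  have h1 := hcT (Y + Z) X
  have h2 := hcT Y X
  have h3 := hcT Z X
  have h4 := hTsym X Y Z
  simp only [map_add, LinearMap.add_apply, hadd] at h1
  have h5 : T X Y Z = ω X Y * c Z + ω X Z * c Y := by linarith
  rw [h5, hu, hu]
  field_simp
end

section
/- Let (V, ω) be a symplectic real vector space of dimension 2n with n ≥ 1, let u ∈ V* be a linear form, and define the trilinear map T : V × V × V → ℝ by T(X,Y,Z) = (1/(2n+1)) (ω(X,Y)u(Z) + ω(X,Z)u(Y)). Then for all X, Y, Z, W, U ∈ V the cyclic identity Σ_{cyc(X,Y,Z)} [ 2ω(Y,Z)T(X,W,U) + ω(Y,W)T(X,Z,U) + ω(Y,U)T(X,Z,W) − ω(Z,W)T(X,Y,U) − ω(Z,U)T(X,Y,W) ] = 0 holds, where Σ_{cyc(X,Y,Z)} denotes the sum over the three cyclic permutations of (X,Y,Z). -/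
/-- Conversely, if `T(X,Y,Z) = (1/(2n+1))(ω(X,Y)u(Z) + ω(X,Z)u(Y))` for a
linear form `u` on a symplectic vector space of dimension `2n`, `n ≥ 1`, then the cyclic
identity holds. -/
theorem cyclic_identity_of_special_form
    (n : ℕ) (hn : 1 ≤ n)
    (V : Type*) [AddCommGroup V] [Module ℝ V] [FiniteDimensional ℝ V]
    (hdim : Module.finrank ℝ V = 2 * n)
    (ω : V →ₗ[ℝ] V →ₗ[ℝ] ℝ)
    (halt : ∀ X : V, ω X X = 0)
    (hnondeg : ∀ X : V, (∀ Y : V, ω X Y = 0) → X = 0)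
    (u : V →ₗ[ℝ] ℝ)
    (T : V → V → V → ℝ)
    (hT : ∀ X Y Z : V,
      T X Y Z = (1 / (2 * (n : ℝ) + 1)) * (ω X Y * u Z + ω X Z * u Y)) :
    ∀ X Y Z W U : V,
      (2 * ω Y Z * T X W U + ω Y W * T X Z U + ω Y U * T X Z W
        - ω Z W * T X Y U - ω Z U * T X Y W)
      + (2 * ω Z X * T Y W U + ω Z W * T Y X U + ω Z U * T Y X W
        - ω X W * T Y Z U - ω X U * T Y Z W)
      + (2 * ω X Y * T Z W U + ω X W * T Z Y U + ω X U * T Z Y W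
        - ω Y W * T Z X U - ω Y U * T Z X W) = 0 := by
  intro X Y Z W U
  have hs : ∀ A B : V, ω A B = - ω B A := by
    intro A B
    have h := halt (A + B)
    simp only [map_add, LinearMap.add_apply, halt] at h
    linarith
  simp only [hT]
  rw [hs Z Y, hs Y X, hs X Z]
  ring
end

section
/- Let (V, ω) be a symplectic real vector space of dimension 2n with n ≥ 2, and let T : V × V × V → ℝ be a trilinear map that is symmetric in its last two arguments and satisfies, for all X, Y, Z, W, U ∈ V, the cyclic identity Σ_{cyc(X,Y,Z)} [ 2ω(Y,Z)T(X,W,U) + ω(Y,W)T(X,Z,U) + ω(Y,U)T(X,Z,W) − ω(Z,W)T(X,Y,U) − ω(Z,U)T(X,Y,W) ] = 0. Then the full cyclic sum of T vanishes: T(X,Y,Z) + T(Y,Z,X) + T(Z,X,Y) = 0 for all X, Y, Z ∈ V. -/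
/-- Under the hypotheses of Statement 0 (trilinear `T`, symmetric in its last
two arguments, satisfying the cyclic identity, on a symplectic space of dimension `2n`,
`n ≥ 2`), the full cyclic sum of `T` vanishes. -/
theorem cyclic_sum_vanishes
    (n : ℕ) (hn : 2 ≤ n)
    (V : Type*) [AddCommGroup V] [Module ℝ V] [FiniteDimensional ℝ V]
    (hdim : Module.finrank ℝ V = 2 * n)
    (ω : V →ₗ[ℝ] V →ₗ[ℝ] ℝ)
    (halt : ∀ X : V, ω X X = 0)
    (hnondeg : ∀ X : V, (∀ Y : V, ω X Y = 0) → X = 0)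
    (T : V →ₗ[ℝ] V →ₗ[ℝ] V →ₗ[ℝ] ℝ)
    (hTsym : ∀ X Y Z : V, T X Y Z = T X Z Y)
    (hcyc : ∀ X Y Z W U : V,
      (2 * ω Y Z * T X W U + ω Y W * T X Z U + ω Y U * T X Z W
        - ω Z W * T X Y U - ω Z U * T X Y W)
      + (2 * ω Z X * T Y W U + ω Z W * T Y X U + ω Z U * T Y X W
        - ω X W * T Y Z U - ω X U * T Y Z W)
      + (2 * ω X Y * T Z W U + ω X W * T Z Y U + ω X U * T Z Y W
        - ω Y W * T Z X U - ω Y U * T Z X W) = 0) :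
    ∀ X Y Z : V, T X Y Z + T Y Z X + T Z X Y = 0 := by
  have hskew : ∀ X Y : V, ω X Y = - ω Y X := by
    intro X Y
    have h := halt (X + Y)
    simp only [map_add, LinearMap.add_apply, halt] at h
    linarith
  -- It suffices, by polarization, to show that `T X X X = 0`.
  have hdiag : ∀ X : V, T X X X = 0 := by
    intro X
    by_cases hX : X = 0
    · simp [hX]
    have hA : ∃ A, ω X A ≠ 0 := by
      by_contra hcon
      push Not at hcon
      exact hX (hnondeg X hcon)
    obtain ⟨A, hA⟩ := hA
    have hker : ∃ Y ∈ LinearMap.ker ((ω X).prod (ω A)), Y ≠ 0 := by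
      apply Submodule.exists_mem_ne_zero_of_ne_bot
      apply LinearMap.ker_ne_bot_of_finrank_lt
      rw [hdim, Module.finrank_prod, Module.finrank_self]
      omega
    obtain ⟨Y, hY, hY0⟩ := hker
    simp only [LinearMap.mem_ker, LinearMap.prod_apply, Function.prod, Prod.mk_eq_zero] at hY
    obtain ⟨hXY, hAY⟩ := hY
    have hZ : ∃ Z, ω Y Z ≠ 0 := by
      by_contra hcon
      push Not at hcon
      exact hY0 (hnondeg Y hcon)
    obtain ⟨Z, hZ⟩ := hZ
    have hYA : ω Y A = 0 := by rw [hskew, hAY, neg_zero]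
    have hYX : ω Y X = 0 := by rw [hskew, hXY, neg_zero]
    obtain ⟨Z', hZ'⟩ : ∃ Z', Z' = Z - (ω X Z / ω X A) • A := ⟨_, rfl⟩
    have hXZ' : ω X Z' = 0 := by
      rw [hZ', map_sub, map_smul, smul_eq_mul, div_mul_cancel₀ _ hA, sub_self]
    have hYZ' : ω Y Z' ≠ 0 := by
      rw [hZ', map_sub, map_smul, hYA, smul_zero, sub_zero]
      exact hZ
    have hZX' : ω Z' X = 0 := by rw [hskew, hXZ', neg_zero]
    have h := hcyc X Y Z' X X
    simp only [hXY, hYX, hXZ', hZX', halt] at h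
    have h2 : ω Y Z' * T X X X = 0 := by linarith
    exact (mul_eq_zero.mp h2).resolve_left hYZ'
  intro X Y Z
  have h1 := hdiag (X + Y + Z)
  have h2 := hdiag (X + Y)
  have h3 := hdiag (Y + Z)
  have h4 := hdiag (X + Z)
  simp only [map_add, LinearMap.add_apply, hdiag] at h1 h2 h3 h4
  have e1 := hTsym X Y Z
  have e2 := hTsym Y Z X
  have e3 := hTsym Z X Y
  linarith
end

section
/- Let (V, ω) be a symplectic real vector space of dimension 2n ≥ 4, and let B be a linear endomorphism of V such that for all X, Y, Z ∈ V: ω(BY,Z)·X − ω(BX,Z)·Y + ω(X,Z)·BY − ω(Y,Z)·BX = 0. Then B is a scalar multiple of the identity, i.e. there exists b ∈ ℝ with B = b·Id_V. -/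
/-- If `B` is an endomorphism of a symplectic vector space of dimension
`2n ≥ 4` with `ω(BY,Z)X − ω(BX,Z)Y + ω(X,Z)BY − ω(Y,Z)BX = 0` for all `X, Y, Z`, then
`B` is a scalar multiple of the identity. -/
theorem endomorphism_is_scalar
    (n : ℕ) (hn : 2 ≤ n)
    (V : Type*) [AddCommGroup V] [Module ℝ V] [FiniteDimensional ℝ V]
    (hdim : Module.finrank ℝ V = 2 * n)
    (ω : V →ₗ[ℝ] V →ₗ[ℝ] ℝ)
    (halt : ∀ X : V, ω X X = 0)
    (hnondeg : ∀ X : V, (∀ Y : V, ω X Y = 0) → X = 0)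
    (B : V →ₗ[ℝ] V)
    (hB : ∀ X Y Z : V,
      ω (B Y) Z • X - ω (B X) Z • Y + ω X Z • B Y - ω Y Z • B X = 0) :
    ∃ b : ℝ, B = b • LinearMap.id := by
  -- take the trace in `Y` of the identity
  have key : ∀ X Z : V, (2 * (n : ℝ)) * ω (B X) Z = LinearMap.trace ℝ V B * ω X Z := by
    intro X Z
    have h : ((ω.flip Z).comp B).smulRight X - ω (B X) Z • LinearMap.id
        + ω X Z • B - (ω.flip Z).smulRight (B X) = 0 := by
      ext Y
      simpa using hB X Y Z
    have ht := congrArg (LinearMap.trace ℝ V) h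
    simp only [map_add, map_sub, map_smul, map_zero, LinearMap.trace_smulRight,
      LinearMap.trace_id, hdim, LinearMap.comp_apply, LinearMap.flip_apply, smul_eq_mul] at ht
    push_cast at ht
    linarith
  have hn0 : (2 * (n : ℝ)) ≠ 0 := by
    have : n ≠ 0 := by omega
    positivity
  refine ⟨LinearMap.trace ℝ V B / (2 * n), ?_⟩
  ext X
  rw [← sub_eq_zero]
  apply hnondeg
  intro Z
  have := key X Z
  simp only [map_sub, LinearMap.sub_apply, LinearMap.smul_apply, LinearMap.id_apply, map_smul,
    smul_eq_mul]
  field_simp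
  linarith
end

section
/- Let (V, ω) be a symplectic real vector space of dimension 2n with n ≥ 1, and let r : V × V → ℝ be a symmetric bilinear form. Define E(X,Y,Z,W) = (−1/(2(n+1))) [ 2ω(X,Y)r(Z,W) + ω(X,Z)r(Y,W) + ω(X,W)r(Y,Z) − ω(Y,Z)r(X,W) − ω(Y,W)r(X,Z) ], and for X, Y ∈ V let Ē(X,Y) be the unique endomorphism of V with ω(Ē(X,Y)Z, W) = E(X,Y,Z,W) for all Z, W (which exists by nondegeneracy of ω). Then the Ricci contraction of E recovers r: for all X, Y ∈ V, trace(Z ↦ Ē(X,Z)Y) = r(X,Y). -/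
/-- The Ricci contraction of the Ricci-type tensor `E` built from a symmetric
bilinear form `r` recovers `r`: `trace (Z ↦ Ē(X,Z)Y) = r(X,Y)`. -/
theorem ricci_contraction_of_E
    (n : ℕ) (hn : 1 ≤ n)
    (V : Type*) [AddCommGroup V] [Module ℝ V] [FiniteDimensional ℝ V]
    (hdim : Module.finrank ℝ V = 2 * n)
    (ω : V →ₗ[ℝ] V →ₗ[ℝ] ℝ)
    (halt : ∀ X : V, ω X X = 0)
    (hnondeg : ∀ X : V, (∀ Y : V, ω X Y = 0) → X = 0)
    (r : V →ₗ[ℝ] V →ₗ[ℝ] ℝ)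
    (hrsym : ∀ X Y : V, r X Y = r Y X)
    (E : V → V → V → V → ℝ)
    (hE : ∀ X Y Z W : V,
      E X Y Z W = (-1 / (2 * ((n : ℝ) + 1))) *
        (2 * ω X Y * r Z W + ω X Z * r Y W + ω X W * r Y Z
          - ω Y Z * r X W - ω Y W * r X Z))
    (Ebar : V →ₗ[ℝ] V →ₗ[ℝ] Module.End ℝ V)
    (hEbar : ∀ X Y Z W : V, ω (Ebar X Y Z) W = E X Y Z W) :
    ∀ X Y : V,
      LinearMap.trace ℝ V ((LinearMap.applyₗ Y).comp (Ebar X)) = r X Y := by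
  intro X Y
  have hskew : ∀ X Y : V, ω X Y = - ω Y X := by
    intro X Y
    have h := halt (X + Y)
    simp only [map_add, LinearMap.add_apply, halt] at h
    linarith
  have hinj : Function.Injective ω := by
    rw [injective_iff_map_eq_zero]
    intro a ha
    exact hnondeg a (fun Y => by rw [ha]; rfl)
  let e : V ≃ₗ[ℝ] Module.Dual ℝ V :=
    LinearEquiv.ofInjectiveOfFinrankEq ω hinj Subspace.dual_finrank_eq.symm
  have he : ∀ x, e x = ω x := fun x => rfl
  let A : V →ₗ[ℝ] V := e.symm.toLinearMap ∘ₗ r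
  have hA : ∀ Z W, ω (A Z) W = r Z W := by
    intro Z W
    rw [← he]
    simp [A]
  have htr : LinearMap.trace ℝ V A = 0 := by
    have h1 : e.conj A = (-1 : ℝ) • Module.Dual.transpose (R := ℝ) A := by
      ext f W
      obtain ⟨Z, rfl⟩ := e.surjective f
      have h2 : e.conj A (e Z) = ω (A Z) := by
        rw [← he, LinearEquiv.conj_apply_apply, LinearEquiv.symm_apply_apply]
      rw [h2, hA, hrsym, ← hA, hskew]
      simp [Module.Dual.transpose_apply, he]
    have h3 := LinearMap.trace_conj' A e
    rw [h1, map_smul, LinearMap.trace_transpose', smul_eq_mul] at h3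
    linarith
  have key : (LinearMap.applyₗ Y).comp (Ebar X) = (-1 / (2 * ((n : ℝ) + 1))) •
      ((2 : ℝ) • (ω X).smulRight (A Y) + ω X Y • A + (r Y).smulRight X
        + (ω Y).smulRight (A X) - r X Y • LinearMap.id) := by
    ext Z
    apply hinj
    ext W
    simp only [LinearMap.comp_apply, LinearMap.applyₗ_apply_apply, hEbar, hE, LinearMap.smul_apply,
      LinearMap.add_apply, LinearMap.sub_apply, LinearMap.smulRight_apply, map_smul, map_add,
      map_sub, hA, smul_eq_mul, LinearMap.id_apply]
    rw [hskew Z Y, hrsym Z Y]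
    ring
  rw [key]
  simp only [map_smul, map_add, map_sub, LinearMap.trace_smulRight, htr, LinearMap.trace_id, hdim,
    smul_eq_mul]
  rw [hskew X (A Y), hskew Y (A X), hA, hA, hrsym Y X]
  have : (n : ℝ) + 1 ≠ 0 := by positivity
  push_cast
  field_simp
  ring
end

section
/- Let (V, ω) be a symplectic real vector space of dimension 2n with n ≥ 1, and let R : V × V × V × V → ℝ be a quadrilinear map that is antisymmetric in its first two arguments, symmetric in its last two arguments, and satisfies the first Bianchi identity R(X,Y,Z,W) + R(Y,Z,X,W) + R(Z,X,Y,W) = 0. Let R̄(X,Y) be the endomorphism with ω(R̄(X,Y)Z,W) = R(X,Y,Z,W), define the Ricci tensor r(X,Y) = trace(Z ↦ R̄(X,Z)Y), and define E from r by E(X,Y,Z,W) = (−1/(2(n+1))) [ 2ω(X,Y)r(Z,W) + ω(X,Z)r(Y,W) + ω(X,W)r(Y,Z) − ω(Y,Z)r(X,W) − ω(Y,W)r(X,Z) ]. Then r is a symmetric bilinear form, and the tensor W := R − E has vanishing Ricci contraction: trace(Z ↦ W̄(X,Z)Y) = 0 for all X, Y ∈ V, where W̄ is the endomorphism form of W.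 -/
theorem trace_zero_of_sp {V : Type*} [AddCommGroup V] [Module ℝ V] [FiniteDimensional ℝ V]
    (e : V ≃ₗ[ℝ] Module.Dual ℝ V) (A : Module.End ℝ V)
    (h : ∀ Z W : V, e (A Z) W = - e Z (A W)) : LinearMap.trace ℝ V A = 0 := by
  have h1 : e.conj A = - Module.Dual.transpose (R := ℝ) A := by
    ext f W
    have := h (e.symm f) W
    simpa [LinearEquiv.conj_apply, Module.Dual.transpose_apply] using this
  have h2 := LinearMap.trace_conj' A e
  have h3 : LinearMap.trace ℝ (Module.Dual ℝ V) (- Module.Dual.transpose (R := ℝ) A) =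
      - LinearMap.trace ℝ (Module.Dual ℝ V) (Module.Dual.transpose (R := ℝ) A) :=
    map_neg (LinearMap.trace ℝ (Module.Dual ℝ V)) _
  rw [h1, h3, LinearMap.trace_transpose'] at h2
  linarith


/-- For a symplectic curvature tensor `R` (antisymmetric in its first two
arguments, symmetric in its last two, satisfying the first Bianchi identity), the Ricci
tensor `r` is symmetric and the tensor `W = R − E` has vanishing Ricci contraction. -/
theorem ricci_decomposition_trace_free
    (n : ℕ) (hn : 1 ≤ n)
    (V : Type*) [AddCommGroup V] [Module ℝ V] [FiniteDimensional ℝ V]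
    (hdim : Module.finrank ℝ V = 2 * n)
    (ω : V →ₗ[ℝ] V →ₗ[ℝ] ℝ)
    (halt : ∀ X : V, ω X X = 0)
    (hnondeg : ∀ X : V, (∀ Y : V, ω X Y = 0) → X = 0)
    (R : V → V → V → V → ℝ)
    (hanti : ∀ X Y Z W : V, R Y X Z W = - R X Y Z W)
    (hsym : ∀ X Y Z W : V, R X Y W Z = R X Y Z W)
    (hBianchi : ∀ X Y Z W : V, R X Y Z W + R Y Z X W + R Z X Y W = 0)
    (Rbar : V →ₗ[ℝ] V →ₗ[ℝ] Module.End ℝ V)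
    (hRbar : ∀ X Y Z W : V, ω (Rbar X Y Z) W = R X Y Z W)
    (r : V → V → ℝ)
    (hr : ∀ X Y : V,
      r X Y = LinearMap.trace ℝ V ((LinearMap.applyₗ Y).comp (Rbar X)))
    (E : V → V → V → V → ℝ)
    (hE : ∀ X Y Z W : V,
      E X Y Z W = (-1 / (2 * ((n : ℝ) + 1))) *
        (2 * ω X Y * r Z W + ω X Z * r Y W + ω X W * r Y Z
          - ω Y Z * r X W - ω Y W * r X Z))
    (Wbar : V →ₗ[ℝ] V →ₗ[ℝ] Module.End ℝ V)
    (hWbar : ∀ X Y Z W : V, ω (Wbar X Y Z) W = R X Y Z W - E X Y Z W) :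
    (∀ X Y : V, r X Y = r Y X) ∧
    (∀ X Y : V,
      LinearMap.trace ℝ V ((LinearMap.applyₗ Y).comp (Wbar X)) = 0) := by
  have hskew : ∀ X Y, ω X Y = - ω Y X := by
    intro X Y
    have := halt (X + Y)
    simp only [map_add, LinearMap.add_apply, halt] at this
    linarith
  have hinj : Function.Injective ω := by
    rw [injective_iff_map_eq_zero]
    intro X hX
    exact hnondeg X (fun Y => by rw [hX]; rfl)
  let e : V ≃ₗ[ℝ] Module.Dual ℝ V :=
    LinearEquiv.ofInjectiveOfFinrankEq ω hinj Subspace.dual_finrank_eq.symm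
  have he : ∀ X Y, e X Y = ω X Y := fun X Y => rfl
  have hrs : ∀ X Y, r X Y = r Y X := by
    intro X Y
    have h0 : LinearMap.trace ℝ V (Rbar Y X) = 0 := by
      apply trace_zero_of_sp e
      intro Z W
      rw [he, he, hskew Z, hRbar, hRbar, hsym, neg_neg]
    have h1 : (LinearMap.applyₗ Y).comp (Rbar X) - (LinearMap.applyₗ X).comp (Rbar Y)
        = - Rbar Y X := by
      ext Z
      apply hinj
      ext W
      simp only [LinearMap.sub_apply, LinearMap.comp_apply, LinearMap.applyₗ_apply_apply,
        LinearMap.neg_apply, map_sub, map_neg, hRbar]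
      linarith [hBianchi X Z Y W, hanti Y Z X W]
    have h2 := congrArg (LinearMap.trace ℝ V) h1
    rw [map_sub, map_neg, h0, ← hr, ← hr] at h2
    linarith
  refine ⟨hrs, ?_⟩
  let rL : V →ₗ[ℝ] V →ₗ[ℝ] ℝ := LinearMap.mk₂ ℝ r
    (fun a b c => by rw [hr, hr, hr, map_add, LinearMap.comp_add, map_add])
    (fun c a b => by rw [hr, hr, map_smul, LinearMap.comp_smul, map_smul])
    (fun a b c => by rw [hr, hr, hr, map_add, LinearMap.add_comp, map_add])
    (fun c a b => by rw [hr, hr, map_smul, LinearMap.smul_comp, map_smul])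
  have hrL : ∀ X Y, rL X Y = r X Y := fun X Y => rfl
  let ρ : Module.End ℝ V := e.symm.toLinearMap.comp rL
  have hρ : ∀ X Y, ω (ρ X) Y = r X Y := by
    intro X Y
    rw [← he, ← hrL]
    simp [ρ]
  have htρ : LinearMap.trace ℝ V ρ = 0 := by
    apply trace_zero_of_sp e
    intro Z W
    rw [he, he, hskew Z, hρ, hρ, hrs, neg_neg]
  intro X Y
  have hne : (2 * ((n : ℝ) + 1)) ≠ 0 := by positivity
  have key : (LinearMap.applyₗ Y).comp (Wbar X) = (LinearMap.applyₗ Y).comp (Rbar X)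
      - (-1 / (2 * ((n : ℝ) + 1))) •
        ((2 : ℝ) • (ω X).smulRight (ρ Y) + (ω X Y) • ρ + (rL Y).smulRight X
          + (ω Y).smulRight (ρ X) - (r X Y) • (1 : Module.End ℝ V)) := by
    ext Z
    apply hinj
    ext W
    simp only [LinearMap.sub_apply, LinearMap.add_apply, LinearMap.smul_apply,
      LinearMap.comp_apply, LinearMap.applyₗ_apply_apply, LinearMap.smulRight_apply,
      map_sub, map_add, map_smul, smul_eq_mul, Module.End.one_apply, hRbar, hWbar, hE, hρ, hrL]
    rw [hskew Z Y, hrs Z Y, hskew Z W, hskew X W]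
    ring
  rw [key, map_sub, ← hr, map_smul, map_sub, map_add, map_add, map_add, map_smul, map_smul,
    map_smul, htρ, LinearMap.trace_smulRight, LinearMap.trace_smulRight,
    LinearMap.trace_smulRight, LinearMap.trace_one, hdim, hskew X (ρ Y), hskew Y (ρ X),
    hρ, hρ, hrL, hrs Y X]
  simp only [smul_eq_mul]
  push_cast
  field_simp
  ring
end

section
/- Let (V, ω) be a symplectic real vector space of dimension 4 (so n = 2), let A ∈ sp(V,ω), let ū ∈ V, u ∈ V*, and b ∈ ℝ with b ≠ 0. Suppose Aū = 0, the identity (1/5) ū⊗u − (5/6) A³ + bA = 0 holds, and A is nilpotent. Then A² = 0 and A = −(1/(5b)) ū⊗u; in particular, if u ≠ 0 and ū ≠ 0 then A has rank exactly 1. -/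
/-- Case 1 of the 4-dimensional trichotomy: if `A ∈ sp(V,ω)` is nilpotent,
`b ≠ 0`, `Aū = 0` and `(1/5) ū⊗u − (5/6) A³ + bA = 0`, then `A² = 0`,
`A = −(1/(5b)) ū⊗u`, and (when `u ≠ 0`, `ū ≠ 0`) `A` has rank exactly `1`. -/
theorem dim4_nilpotent_case
    (V : Type*) [AddCommGroup V] [Module ℝ V] [FiniteDimensional ℝ V]
    (hdim : Module.finrank ℝ V = 4)
    (ω : V →ₗ[ℝ] V →ₗ[ℝ] ℝ)
    (halt : ∀ X : V, ω X X = 0)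
    (hnondeg : ∀ X : V, (∀ Y : V, ω X Y = 0) → X = 0)
    (A : Module.End ℝ V)
    (hsp : ∀ X Y : V, ω (A X) Y + ω X (A Y) = 0)
    (ubar : V) (u : V →ₗ[ℝ] ℝ) (b : ℝ) (hb : b ≠ 0)
    (h0 : A ubar = 0)
    (h1 : (1 / 5 : ℝ) • (LinearMap.smulRight u ubar : Module.End ℝ V)
        - (5 / 6 : ℝ) • A ^ 3 + b • A = 0)
    (hnil : IsNilpotent A) :
    A ^ 2 = 0 ∧
    A = (-(1 / (5 * b))) • (LinearMap.smulRight u ubar : Module.End ℝ V) ∧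
    (u ≠ 0 → ubar ≠ 0 → LinearMap.rank (A : V →ₗ[ℝ] V) = 1) := by
  have hz : A * (LinearMap.smulRight u ubar : Module.End ℝ V) = 0 := by
    ext x
    simp [h0]
  have h2 : A ^ 2 * (algebraMap ℝ (Module.End ℝ V) b - (5 / 6 : ℝ) • A ^ 2) = 0 := by
    have h3 := congrArg (fun B => A * B) h1
    simp only [mul_add, mul_sub, mul_smul_comm, hz, mul_zero, smul_zero, zero_sub] at h3
    rw [mul_sub, Algebra.algebraMap_eq_smul_one, mul_smul_comm, mul_smul_comm, mul_one, ← pow_add]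
    rw [← pow_succ', ← pow_two] at h3
    rw [← h3]
    norm_num
    abel
  have hunit : IsUnit (algebraMap ℝ (Module.End ℝ V) b - (5 / 6 : ℝ) • A ^ 2) := by
    have hn : IsNilpotent ((5 / 6 : ℝ) • A ^ 2) :=
      (hnil.pow_of_pos two_ne_zero).smul _
    have hu : IsUnit (algebraMap ℝ (Module.End ℝ V) b) := (IsUnit.mk0 b hb).map _
    rw [sub_eq_add_neg]
    exact hn.neg.isUnit_add_left_of_commute hu (Algebra.commutes b _).symm
  have hA2 : A ^ 2 = 0 := hunit.mul_left_eq_zero.mp h2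
  have hA : A = (-(1 / (5 * b))) • (LinearMap.smulRight u ubar : Module.End ℝ V) := by
    have h3 : A ^ 3 = 0 := by rw [pow_succ, hA2, zero_mul]
    rw [h3, smul_zero, sub_zero] at h1
    have h4 : b • A = -((1 / 5 : ℝ) • (LinearMap.smulRight u ubar : Module.End ℝ V)) :=
      eq_neg_of_add_eq_zero_right h1
    have h5 : A = b⁻¹ • (b • A) := by rw [smul_smul, inv_mul_cancel₀ hb, one_smul]
    rw [h5, h4, ← neg_smul, smul_smul]
    congr 1
    field_simp
  refine ⟨hA2, hA, fun hu hub => ?_⟩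
  obtain ⟨x, hx⟩ : ∃ x, u x ≠ 0 := by
    by_contra! h
    exact hu (LinearMap.ext h)
  have hc : (-(1 / (5 * b))) ≠ 0 := by simp [hb]
  have hr : LinearMap.range A = Submodule.span ℝ {ubar} := by
    apply le_antisymm
    · rintro _ ⟨y, rfl⟩
      rw [Submodule.mem_span_singleton]
      refine ⟨(-(1 / (5 * b))) * u y, ?_⟩
      conv_rhs => rw [hA]
      simp [mul_smul]
    · rw [Submodule.span_singleton_le_iff_mem]
      refine ⟨((-(1 / (5 * b))) * u x)⁻¹ • x, ?_⟩
      have h6 : A x = ((-(1 / (5 * b))) * u x) • ubar := by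
        conv_lhs => rw [hA]
        simp [mul_smul]
      rw [map_smul, h6, smul_smul, inv_mul_cancel₀ (mul_ne_zero hc hx), one_smul]
  rw [LinearMap.rank, hr, ← Module.finrank_eq_rank, finrank_span_singleton hub, Nat.cast_one]
end

section
/- Let (V, ω) be a symplectic real vector space of dimension 4 (so n = 2), let A ∈ sp(V,ω), let ū ∈ V with ū ≠ 0, let u ∈ V*, and let b ∈ ℝ. Suppose Aū = 0, the identity (1/5) ū⊗u − (5/6) A³ + bA = 0 holds, and A is not nilpotent. Then b ≠ 0 and the characteristic polynomial of A is X²(X² − 6b/5), i.e. X⁴ − (6b/5)X². In particular, A has the pair of nonzero eigenvalues ±√(6b/5) (real or purely imaginary), each of algebraic multiplicity 1, and 0 is an eigenvalue of algebraic multiplicity 2. -/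
/-- Case 3 of the 4-dimensional trichotomy: if `A ∈ sp(V,ω)` is not
nilpotent, `ū ≠ 0`, `Aū = 0` and `(1/5) ū⊗u − (5/6) A³ + bA = 0`, then `b ≠ 0` and the
characteristic polynomial of `A` is `X⁴ − (6b/5)X²`. -/
theorem dim4_non_nilpotent_case
    (V : Type*) [AddCommGroup V] [Module ℝ V] [FiniteDimensional ℝ V]
    (hdim : Module.finrank ℝ V = 4)
    (ω : V →ₗ[ℝ] V →ₗ[ℝ] ℝ)
    (halt : ∀ X : V, ω X X = 0)
    (hnondeg : ∀ X : V, (∀ Y : V, ω X Y = 0) → X = 0)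
    (A : Module.End ℝ V)
    (hsp : ∀ X Y : V, ω (A X) Y + ω X (A Y) = 0)
    (ubar : V) (hubar : ubar ≠ 0) (u : V →ₗ[ℝ] ℝ) (b : ℝ)
    (h0 : A ubar = 0)
    (h1 : (1 / 5 : ℝ) • (LinearMap.smulRight u ubar : Module.End ℝ V)
        - (5 / 6 : ℝ) • A ^ 3 + b • A = 0)
    (hnotnil : ¬ IsNilpotent A) :
    b ≠ 0 ∧
    LinearMap.charpoly A =
      Polynomial.X ^ 4 - Polynomial.C (6 * b / 5) * Polynomial.X ^ 2 := by
  have e1 : ∀ X, (1/5:ℝ) • u X • ubar - (5/6:ℝ) • A (A (A X)) + b • A X = 0 := by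
    intro X
    have := congrArg (fun f : Module.End ℝ V => f X) h1
    simpa [pow_succ] using this
  have hA4 : A ^ 4 = (6 * b / 5) • A ^ 2 := by
    ext X
    have h := congrArg A (e1 X)
    simp only [map_add, map_sub, map_smul, h0, map_zero, smul_zero, zero_sub] at h
    have h2 : A (A (A (A X))) = (6 * b / 5) • A (A X) := by
      linear_combination (norm := module) (-(6/5):ℝ) • h
    simpa [pow_succ] using h2
  have hA2 : A ^ 2 ≠ 0 := fun h => hnotnil ⟨2, h⟩
  have hb : b ≠ 0 := by
    rintro rfl
    exact hnotnil ⟨4, by simpa using hA4⟩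
  refine ⟨hb, ?_⟩
  have hinj : Function.Injective ω := by
    rw [← LinearMap.ker_eq_bot, LinearMap.ker_eq_bot']
    intro X hX
    exact hnondeg X (fun Y => by simp [hX])
  let e : V ≃ₗ[ℝ] Module.Dual ℝ V :=
    LinearEquiv.ofInjectiveOfFinrankEq ω hinj (by rw [Subspace.dual_finrank_eq])
  have he : ∀ X, e X = ω X := fun X => rfl
  have hev : ∀ t : ℝ, A.charpoly.eval t = LinearMap.det (t • (1 : Module.End ℝ V) - A) := by
    intro t
    rw [LinearMap.eval_charpoly]
    rfl
  have heven : ∀ t : ℝ, A.charpoly.eval (-t) = A.charpoly.eval t := by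
    intro t
    rw [hev, hev]
    have h1 : (-t) • (1 : Module.End ℝ V) - A = (-1 : ℝ) • (t • (1 : Module.End ℝ V) + A) := by
      module
    rw [h1, LinearMap.det_smul, hdim, ← LinearMap.det_conj _ e,
      ← LinearMap.det_dualMap (t • (1 : Module.End ℝ V) - A)]
    have h4 : ((-1 : ℝ)) ^ 4 = 1 := by norm_num
    rw [h4, one_mul]
    refine congrArg (LinearMap.det : Module.End ℝ (Module.Dual ℝ V) →* ℝ) ?_
    apply LinearMap.ext
    intro f
    obtain ⟨X, rfl⟩ := e.surjective f
    ext Y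
    have := hsp X Y
    have hs : e.symm (ω X) = X := by rw [← he, e.symm_apply_apply]
    simp [he, hs]
    linarith
  have hz : A.charpoly.eval 0 = 0 := by
    rw [hev]
    by_contra h
    have hu := LinearMap.ker_eq_bot'.1 (LinearMap.ker_eq_bot.2
      (LinearMap.equivOfDetNeZero _ h).injective) ubar
    apply hubar
    apply hu
    simp [LinearMap.equivOfDetNeZero, h0]
  have hmon := A.charpoly_monic
  have hdeg : A.charpoly.natDegree = 4 := by rw [LinearMap.charpoly_natDegree, hdim]
  have hc := hmon.coeff_natDegree
  rw [hdeg] at hc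
  have hch := A.aeval_self_charpoly
  have hsum := A.charpoly.as_sum_range_C_mul_X_pow
  rw [hdeg] at hsum
  simp only [Finset.sum_range_succ, Finset.sum_range_zero, hc] at hsum
  generalize A.charpoly.coeff 0 = p0 at hsum
  generalize A.charpoly.coeff 1 = p1 at hsum
  generalize A.charpoly.coeff 2 = p2 at hsum
  generalize A.charpoly.coeff 3 = p3 at hsum
  have k1 := heven 1
  have k2 := heven 2
  rw [hsum] at k1 k2 hz hch
  simp at k1 k2 hz hch
  have q1 : p1 = 0 := by linarith
  have q3 : p3 = 0 := by linarith
  subst q1 q3 hz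
  rw [hA4] at hch
  have q2 : (p2 + 6 * b / 5) • A ^ 2 = 0 := by
    rw [add_smul]
    simpa [Algebra.algebraMap_eq_smul_one] using hch
  have q : p2 = -(6 * b / 5) := by
    rcases smul_eq_zero.1 q2 with h | h
    · linarith
    · exact absurd h hA2
  rw [hsum, q]
  simp
  ring
end
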